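/- (Conditional mean of the LMC, Proposition 2, part 1.) Let p ≥ 1, let A be an invertible real p×p matrix with columns a_1,…,a_p and with b_1,…,b_p the rows of A⁻¹. Let R_1,…,R_p be symmetric positive definite real matrices indexed by the disjoint union O ⊔ P of a finite observed index set O and a finite prediction index set P, with blocks R^{(j)}_{OO}, R^{(j)}_{OP}, R^{(j)}_{PO}, R^{(j)}_{PP}. Let Σ = ∑_{j=1}^p R_j ⊗ (a_j a_jᵀ), with corresponding blocks Σ_{OO}, Σ_{OP}, Σ_{PO}, Σ_{PP}. Then the Gaussian conditional-mean operator satisfies Σ_{PO} · Σ_{OO}⁻¹ = ∑_{j=1}^p (R^{(j)}_{PO} (R^{(j)}_{OO})⁻¹) ⊗ (a_j b_j), where a_j b_j is the p×p outer product of the column a_j with the row b_j; consequently, applied to vec(V_O) for a p×|O| matrix V_O it yields vec(∑_{j=1}^p a_j b_j V_O (R^{(j)}_{OO})⁻¹ R^{(j)}_{OP}). -/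

import Mathlib

open Matrix
open scoped Kronecker

/-- Sums of Kronecker products with rank-one matrices multiply termwise when the inner vectors
are biorthogonal. -/
lemma sum_kronecker_vecMulVec_mul {ι l m n k α : Type*} [Fintype ι] [DecidableEq ι]
    [Fintype m] [Fintype k] [CommRing α]
    (X : ι → Matrix l m α) (Y : ι → Matrix m n α) (u a b v : ι → k → α)
    (hab : ∀ i j, a i ⬝ᵥ b j = if i = j then 1 else 0) :
    (∑ i, X i ⊗ₖ vecMulVec (u i) (a i)) * (∑ j, Y j ⊗ₖ vecMulVec (b j) (v j)) =
      ∑ i, (X i * Y i) ⊗ₖ vecMulVec (u i) (v i) := by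
  rw [Matrix.sum_mul]
  refine Finset.sum_congr rfl fun i _ => ?_
  rw [Matrix.mul_sum, Finset.sum_eq_single i]
  · rw [← mul_kronecker_mul, vecMulVec_mul_vecMulVec, hab]
    simp
  · intro j _ hj
    rw [← mul_kronecker_mul, vecMulVec_mul_vecMulVec, hab, if_neg hj.symm]
    simp
  · simp

/-- A matrix product is the sum of the outer products of columns with rows. -/
lemma sum_vecMulVec_col_row {l m n α : Type*} [Fintype m] [CommRing α]
    (A : Matrix l m α) (B : Matrix m n α) :
    ∑ j, vecMulVec (fun i => A i j) (B j) = A * B := by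
  ext i k
  simp [Matrix.sum_apply, vecMulVec_apply, Matrix.mul_apply]

lemma kronecker_mulVec_apply {l m n k α : Type*} [Fintype m] [Fintype k] [CommRing α]
    (K : Matrix l m α) (M : Matrix n k α) (V : Matrix k m α) (t : l × n) :
    ((K ⊗ₖ M) *ᵥ fun s : m × k => V s.2 s.1) t = (M * V * Kᵀ) t.2 t.1 := by
  simp only [mulVec, dotProduct, Fintype.sum_prod_type, kroneckerMap_apply, Matrix.mul_apply,
    transpose_apply, Finset.sum_mul]
  exact Finset.sum_congr rfl fun _ _ => Finset.sum_congr rfl fun _ _ => by ring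

/-- **Conditional mean of the LMC (Proposition 2, part 1).**
For `Σ = ∑ⱼ Rⱼ ⊗ aⱼaⱼᵀ` over locations `O ⊕ P`, the conditional-mean operator
satisfies `Σ_PO Σ_OO⁻¹ = ∑ⱼ (R_PO⁽ʲ⁾ (R_OO⁽ʲ⁾)⁻¹) ⊗ aⱼbⱼ`, and applied to
`vec(V_O)` it yields `vec(∑ⱼ aⱼ bⱼ V_O (R_OO⁽ʲ⁾)⁻¹ R_OP⁽ʲ⁾)`. -/
theorem lmc_conditional_mean (p : ℕ) (hp : 1 ≤ p)
    (O P : Type) [Fintype O] [Fintype P] [DecidableEq O] [DecidableEq P]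
    (A : Matrix (Fin p) (Fin p) ℝ) (hA : IsUnit A.det)
    (R : Fin p → Matrix (O ⊕ P) (O ⊕ P) ℝ) (hR : ∀ j, (R j).PosDef)
    (Sig : Matrix ((O ⊕ P) × Fin p) ((O ⊕ P) × Fin p) ℝ)
    (hSig : Sig = ∑ j : Fin p, (R j) ⊗ₖ vecMulVec (fun i => A i j) (fun k => A k j))
    (SigPO : Matrix (P × Fin p) (O × Fin p) ℝ)
    (hSigPO : SigPO = Sig.submatrix (fun si => (Sum.inr si.1, si.2))
      (fun ti => (Sum.inl ti.1, ti.2)))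
    (SigOO : Matrix (O × Fin p) (O × Fin p) ℝ)
    (hSigOO : SigOO = Sig.submatrix (fun si => (Sum.inl si.1, si.2))
      (fun ti => (Sum.inl ti.1, ti.2))) :
    SigPO * SigOO⁻¹ =
      (∑ j : Fin p, ((R j).toBlocks₂₁ * ((R j).toBlocks₁₁)⁻¹) ⊗ₖ
        vecMulVec (fun i => A i j) (A⁻¹ j)) ∧
    ∀ V_O : Matrix (Fin p) O ℝ,
      (SigPO * SigOO⁻¹) *ᵥ (fun si : O × Fin p => V_O si.2 si.1) =
        fun ti : P × Fin p =>
          (∑ j : Fin p, vecMulVec (fun i => A i j) (A⁻¹ j) * V_O *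
            ((R j).toBlocks₁₁)⁻¹ * (R j).toBlocks₁₂) ti.2 ti.1 := by
  have hBA : ∀ i j, (fun k => A k i) ⬝ᵥ A⁻¹ j = if i = j then 1 else 0 := by
    intro i j
    have h := congrFun (congrFun (nonsing_inv_mul A hA) j) i
    rw [Matrix.mul_apply, Matrix.one_apply] at h
    simp only [dotProduct, eq_comm (a := i)]
    simpa only [mul_comm] using h
  have hpos : ∀ j, (R j).toBlocks₁₁.PosDef := fun j =>
    (hR j).submatrix Sum.inl_injective
  have hunit : ∀ j, IsUnit (R j).toBlocks₁₁.det := fun j =>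
    (Matrix.isUnit_iff_isUnit_det _).mp (hpos j).isUnit
  have hOO : SigOO = ∑ j, (R j).toBlocks₁₁ ⊗ₖ
      vecMulVec (fun i => A i j) (fun k => A k j) := by
    subst hSigOO hSig
    ext s t
    simp [Matrix.sum_apply, toBlocks₁₁]
  have hPO : SigPO = ∑ j, (R j).toBlocks₂₁ ⊗ₖ
      vecMulVec (fun i => A i j) (fun k => A k j) := by
    subst hSigPO hSig
    ext s t
    simp [Matrix.sum_apply, toBlocks₂₁]
  have hinv : SigOO⁻¹ = ∑ j, ((R j).toBlocks₁₁)⁻¹ ⊗ₖ vecMulVec (A⁻¹ j) (A⁻¹ j) := by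
    apply Matrix.inv_eq_right_inv
    rw [hOO]
    refine (sum_kronecker_vecMulVec_mul _ _ (fun j i => A i j) (fun j k => A k j)
      (fun j => A⁻¹ j) (fun j => A⁻¹ j) hBA).trans ?_
    simp only [mul_nonsing_inv _ (hunit _)]
    have h : ∑ j, (1 : Matrix O O ℝ) ⊗ₖ vecMulVec (fun i => A i j) (A⁻¹ j) =
        (1 : Matrix O O ℝ) ⊗ₖ ∑ j, vecMulVec (fun i => A i j) (A⁻¹ j) := by
      ext s t
      simp [Matrix.sum_apply, Finset.mul_sum]
    rw [h, sum_vecMulVec_col_row, mul_nonsing_inv A hA, one_kronecker_one]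
  have hmean : SigPO * SigOO⁻¹ = ∑ j, ((R j).toBlocks₂₁ * ((R j).toBlocks₁₁)⁻¹) ⊗ₖ
      vecMulVec (fun i => A i j) (A⁻¹ j) := by
    rw [hPO, hinv]
    exact sum_kronecker_vecMulVec_mul _ _ (fun j i => A i j) (fun j k => A k j)
      (fun j => A⁻¹ j) (fun j => A⁻¹ j) hBA
  refine ⟨hmean, fun V_O => ?_⟩
  have htr : ∀ j, ((R j).toBlocks₂₁ * ((R j).toBlocks₁₁)⁻¹)ᵀ =
      ((R j).toBlocks₁₁)⁻¹ * (R j).toBlocks₁₂ := by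
    intro j
    have hsymm : (R j)ᵀ = R j := by simpa using (hR j).isHermitian.eq
    have h₁₁ : (R j).toBlocks₁₁ᵀ = (R j).toBlocks₁₁ := by
      simpa using (hpos j).isHermitian.eq
    have h₂₁ : (R j).toBlocks₂₁ᵀ = (R j).toBlocks₁₂ := by
      ext s t
      exact congrFun (congrFun hsymm (Sum.inl s)) (Sum.inr t)
    rw [transpose_mul, transpose_nonsing_inv, h₁₁, h₂₁]
  ext t
  rw [hmean, sum_mulVec, Finset.sum_apply, Matrix.sum_apply]
  refine Finset.sum_congr rfl fun j _ => ?_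
  rw [kronecker_mulVec_apply, htr, ← Matrix.mul_assoc]
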